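/- For the alternating group A_7, one has ed_ℂ(A_7; ≤ 6) > 1. -/

import Mathlib

open IntermediateField Multiplicative

/-- `K` is (the function field of) an irreducible variety over `k`:
a finitely generated field extension of `k`. -/
def IsFunctionField (k K : Type) [Field k] [Field K] [Algebra k K] : Prop :=
  ∃ s : Finset K, IntermediateField.adjoin k (s : Set K) = ⊤

/-- The variety with function field `K` has dimension at most `d`, i.e. the
transcendence degree of `K/k` is at most `d`. -/
def DimLE (k K : Type) [Field k] [Field K] [Algebra k K] (d : ℕ) : Prop :=
  ∃ s : Finset K, s.card ≤ d ∧ Algebra.IsAlgebraic (IntermediateField.adjoin k (s : Set K)) K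

/-- `K` is the function field of an irreducible algebraic curve over `k`: a finitely
generated field extension of `k` of transcendence degree one. -/
def IsCurveField (k K : Type) [Field k] [Field K] [Algebra k K] : Prop :=
  IsFunctionField k K ∧ DimLE k K 1 ∧ ∃ x : K, Transcendental k x

/-- The rational function `f` on the curve with function field `K` has degree `n`,
i.e. the corresponding dominant rational map to `P¹` is generically `n`-to-1:
`[K : k(f)] = n` (in particular this extension is finite). -/
def RatFnDegree (k K : Type) [Field k] [Field K] [Algebra k K] (f : K) (n : ℕ) : Prop :=
  FiniteDimensional (IntermediateField.adjoin k ({f} : Set K)) K ∧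
    Module.finrank (IntermediateField.adjoin k ({f} : Set K)) K = n

/-- A faithful `G`-variety over `k`, in birational terms: a finitely generated
field extension `K/k` (the function field) equipped with a faithful `G`-action
on `K` by `k`-automorphisms (i.e. a faithful action on the variety by birational
automorphisms). -/
structure GVariety (k : Type) [Field k] (G : Type) [Group G] where
  K : Type
  [field : Field K]
  [algebra : Algebra k K]
  fg : IsFunctionField k K
  action : G →* (K ≃ₐ[k] K)
  faithful : Function.Injective action

attribute [instance] GVariety.field GVariety.algebra

section ED

variable {k : Type} [Field k] {G : Type} [Group G]

/-- A `G`-compression `X ⇢ Y`: a dominant rational `G`-map, i.e. a `G`-equivariant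
`k`-embedding of function fields `k(Y) ↪ k(X)`. -/
def GVariety.Compression (X Y : GVariety k G) : Prop :=
  ∃ φ : Y.K →ₐ[k] X.K, ∀ (g : G) (y : Y.K), X.action g (φ y) = φ (Y.action g y)

/-- `T ⇢ X` is a `G`-equivariant branched cover of degree at most `n`: a
`G`-equivariant `k`-embedding of function fields `k(X) ↪ k(T)` with
`[k(T) : k(X)] ≤ n`. -/
def GVariety.IsCoverDegLE (T X : GVariety k G) (n : ℕ) : Prop :=
  ∃ ι : X.K →ₐ[k] T.K,
    FiniteDimensional ι.fieldRange T.K ∧ Module.finrank ι.fieldRange T.K ≤ n ∧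
    ∀ (g : G) (x : X.K), T.action g (ι x) = ι (X.action g x)

end ED

/-- `ed_k(G; ≤ n) ≤ d`: every faithful `G`-variety `X` over `k` admits a
`G`-equivariant branched cover `X̃ ⇢ X` of degree at most `n` together with a
`G`-compression `X̃ ⇢ Y` to a faithful `G`-variety `Y` of dimension at most `d`.
Thus `ed_k(G; ≤ n) > d` is the negation `¬ EDLE k G n d`. -/
def EDLE (k : Type) [Field k] (G : Type) [Group G] (n d : ℕ) : Prop :=
  ∀ X : GVariety k G, ∃ T Y : GVariety k G,
    T.IsCoverDegLE X n ∧ T.Compression Y ∧ DimLE k Y.K d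

section Gauss
variable {L : Type*} [Field L] {σ : Type*}

/-- A multivariate polynomial whose coefficients lie in a valuation ring, one of them being a
unit, times another such polynomial again has a unit coefficient. -/
lemma ValuationSubring.exists_valuation_coeff_mul_eq_one (O : ValuationSubring L)
    {F H : MvPolynomial σ L}
    (hF : ∀ m, O.valuation (F.coeff m) ≤ 1) (hH : ∀ m, O.valuation (H.coeff m) ≤ 1)
    {i j : σ →₀ ℕ} (hi : O.valuation (F.coeff i) = 1) (hj : O.valuation (H.coeff j) = 1) :
    ∃ m, O.valuation ((F * H).coeff m) = 1 := by
  have lift : ∀ P : MvPolynomial σ L, (∀ m, O.valuation (P.coeff m) ≤ 1) →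
      ∃ P₀ : MvPolynomial σ O, MvPolynomial.map O.subtype P₀ = P := by
    intro P hP
    have : P ∈ Set.range (MvPolynomial.map (σ := σ) O.subtype) := by
      rw [MvPolynomial.mem_range_map_iff_coeffs_subset]
      intro x hx
      obtain ⟨m, -, rfl⟩ := MvPolynomial.mem_coeffs_iff.1 hx
      exact ⟨⟨_, (O.valuation_le_one_iff _).1 (hP m)⟩, rfl⟩
    exact this
  obtain ⟨F₀, rfl⟩ := lift F hF
  obtain ⟨H₀, rfl⟩ := lift H hH
  have ne : ∀ (P : MvPolynomial σ O) (i : σ →₀ ℕ),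
      O.valuation ((MvPolynomial.map O.subtype P).coeff i) = 1 ↔
        (MvPolynomial.map (IsLocalRing.residue O) P).coeff i ≠ 0 := by
    intro P i
    rw [MvPolynomial.coeff_map, MvPolynomial.coeff_map, IsLocalRing.residue_ne_zero_iff_isUnit]
    exact (O.valuation_eq_one_iff _).symm
  rw [ne] at hi hj
  have hF0 : MvPolynomial.map (IsLocalRing.residue O) F₀ ≠ 0 := by
    rintro h; simp [h] at hi
  have hH0 : MvPolynomial.map (IsLocalRing.residue O) H₀ ≠ 0 := by
    rintro h; simp [h] at hj
  obtain ⟨m, hm⟩ := MvPolynomial.ne_zero_iff.1 (mul_ne_zero hF0 hH0)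
  refine ⟨m, ?_⟩
  rw [← map_mul, ne, map_mul]
  exact hm

lemma Valuation.exists_max_coeff {Γ : Type*} [LinearOrderedCommGroupWithZero Γ]
    (v : Valuation L Γ) {F : MvPolynomial σ L} (hF : F ≠ 0) :
    ∃ i, F.coeff i ≠ 0 ∧ ∀ m, v (F.coeff m) ≤ v (F.coeff i) := by
  obtain ⟨i, hi, h⟩ := F.support.exists_max_image (fun m => v (F.coeff m))
    (MvPolynomial.support_nonempty.2 hF)
  refine ⟨i, MvPolynomial.mem_support_iff.1 hi, fun m => ?_⟩
  by_cases hm : m ∈ F.support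
  · exact h m hm
  · rw [MvPolynomial.notMem_support_iff.1 hm]; simp

/-- Gauss's lemma: bounds on the coefficients of a product. -/
lemma ValuationSubring.valuation_coeff_mul_coeff_le (O : ValuationSubring L)
    {F H : MvPolynomial σ L} {γ : O.ValueGroup}
    (h : ∀ m, O.valuation ((F * H).coeff m) ≤ γ) (i j : σ →₀ ℕ) :
    O.valuation (F.coeff i * H.coeff j) ≤ γ := by
  by_cases hF : F = 0
  · simp [hF]
  by_cases hH : H = 0
  · simp [hH]
  obtain ⟨i₀, hi₀, hi⟩ := O.valuation.exists_max_coeff hF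
  obtain ⟨j₀, hj₀, hj⟩ := O.valuation.exists_max_coeff hH
  set a := F.coeff i₀
  set b := H.coeff j₀
  have hva : O.valuation a ≠ 0 := by simpa using hi₀
  have hvb : O.valuation b ≠ 0 := by simpa using hj₀
  obtain ⟨m, hm⟩ := O.exists_valuation_coeff_mul_eq_one
    (F := MvPolynomial.C a⁻¹ * F) (H := MvPolynomial.C b⁻¹ * H) (i := i₀) (j := j₀)
    (fun m => by
      rw [MvPolynomial.coeff_C_mul, map_mul, map_inv₀]
      exact inv_mul_le_one_of_le₀ (hi m) zero_le)
    (fun m => by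
      rw [MvPolynomial.coeff_C_mul, map_mul, map_inv₀]
      exact inv_mul_le_one_of_le₀ (hj m) zero_le)
    (by rw [MvPolynomial.coeff_C_mul, inv_mul_cancel₀ hi₀, map_one])
    (by rw [MvPolynomial.coeff_C_mul, inv_mul_cancel₀ hj₀, map_one])
  have e : MvPolynomial.C a⁻¹ * F * (MvPolynomial.C b⁻¹ * H)
      = MvPolynomial.C (a * b)⁻¹ * (F * H) := by
    rw [mul_inv, MvPolynomial.C_mul]; ring
  rw [e, MvPolynomial.coeff_C_mul, map_mul, map_inv₀] at hm
  have hab : O.valuation (a * b) ≠ 0 := by rw [map_mul]; exact mul_ne_zero hva hvb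
  have : O.valuation ((F * H).coeff m) = O.valuation (a * b) := by
    field_simp at hm
    exact hm
  calc O.valuation (F.coeff i * H.coeff j) ≤ O.valuation (a * b) := by
        rw [map_mul, map_mul]; exact mul_le_mul' (hi i) (hj j)
    _ ≤ γ := this ▸ h m

end Gauss

section Poles
variable {k L : Type*} [Field k] [Field L] [Algebra k L]

variable (k) in
/-- The functions whose pole divisor is at most `n` times the pole divisor of `s`. -/
def poleSpace (s : L) (n : ℕ) : Submodule k L where
  carrier := {y | ∀ O : ValuationSubring L, (∀ c : k, algebraMap k L c ∈ O) →
    O.valuation y ≤ max 1 (O.valuation s) ^ n}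
  zero_mem' := fun O _ => by simp
  add_mem' := fun {a b} ha hb O hO =>
    (O.valuation.map_add a b).trans (max_le (ha O hO) (hb O hO))
  smul_mem' := fun c y hy O hO => by
    rw [Algebra.smul_def, map_mul]
    exact (mul_le_mul' ((O.valuation_le_one_iff _).2 (hO c)) (hy O hO)).trans_eq (one_mul _)

lemma isIntegral_of_mem_poleSpace_zero {s y : L} (hy : y ∈ poleSpace k s 0) :
    IsIntegral k y := by
  have h : y ∈ (⨅ V : {V : ValuationSubring L // Set.range (algebraMap k L) ⊆ V.toSubring},
      V.1.toSubring) := by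
    rw [Subring.mem_iInf]
    rintro ⟨V, hV⟩
    have := hy V (fun c => hV ⟨c, rfl⟩)
    rw [pow_zero] at this
    exact (V.valuation_le_one_iff _).1 this
  rw [iInf_valuationSubring_superset] at h
  have h' : IsIntegral (Subring.closure (Set.range (algebraMap k L))) y := h
  have e : Subring.closure (Set.range (algebraMap k L)) = (algebraMap k L).range := by
    rw [← RingHom.coe_range, Subring.closure_eq]
  rw [e] at h'
  obtain ⟨p, hp, hp0⟩ := h'
  have hl : p ∈ Polynomial.lifts (algebraMap k L).rangeRestrict := by
    rw [Polynomial.lifts_iff_coeff_lifts]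
    exact fun n => (algebraMap k L).rangeRestrict_surjective _
  obtain ⟨q, hq, -, hqm⟩ := Polynomial.lifts_and_degree_eq_and_monic hl hp
  refine ⟨q, hqm, ?_⟩
  rw [← hq, Polynomial.eval₂_map] at hp0
  exact hp0

lemma valuation_aeval_le (O : ValuationSubring L) (hO : ∀ c : k, algebraMap k L c ∈ O) (s : L)
    (p : Polynomial k) {n : ℕ} (hn : p.natDegree ≤ n) :
    O.valuation (Polynomial.aeval s p) ≤ max 1 (O.valuation s) ^ n := by
  rw [Polynomial.aeval_eq_sum_range]
  refine O.valuation.map_sum_le fun i hi => ?_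
  rw [Algebra.smul_def, map_mul, map_pow]
  refine (mul_le_mul' ((O.valuation_le_one_iff _).2 (hO _)) le_rfl).trans ?_
  rw [one_mul]
  refine (pow_le_pow_left' (le_max_right 1 _) i).trans (pow_le_pow_right' (le_max_left _ _) ?_)
  have := Finset.mem_range.1 hi
  omega

lemma aeval_mul_mem_poleSpace {s y : L} {c n : ℕ} (hy : y ∈ poleSpace k s c)
    (p : Polynomial k) (hn : p.natDegree ≤ n) :
    Polynomial.aeval s p * y ∈ poleSpace k s (n + c) := fun O hO => by
  rw [map_mul, pow_add]
  exact mul_le_mul' (valuation_aeval_le O hO s p hn) (hy O hO)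

lemma poleSpace_mono {s : L} {m n : ℕ} (h : m ≤ n) : poleSpace k s m ≤ poleSpace k s n :=
  fun _ hy O hO => (hy O hO).trans (pow_le_pow_right' (le_max_left _ _) h)

lemma exists_mem_poleSpace_of_isIntegral {s y : L}
    (hy : IsIntegral (Algebra.adjoin k ({s} : Set L)) y) : ∃ c, y ∈ poleSpace k s c := by
  obtain ⟨p, hp, hp0⟩ := hy
  have hc : ∀ i, ∃ q : Polynomial k, Polynomial.aeval s q = (p.coeff i : L) := fun i => by
    have : (p.coeff i : L) ∈ (Polynomial.aeval (R := k) s).range :=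
      Algebra.adjoin_singleton_eq_range_aeval k s ▸ (p.coeff i).2
    exact this
  choose q hq using hc
  set c := (Finset.range p.natDegree).sup (fun i => (q i).natDegree)
  refine ⟨c, fun O hO => ?_⟩
  by_contra! hlt
  set M := max 1 (O.valuation s) ^ c
  have hM : 1 ≤ M := one_le_pow_of_one_le' (le_max_left _ _) c
  have hy1 : 1 < O.valuation y := hM.trans_lt hlt
  have hy0 : O.valuation y ≠ 0 := (zero_lt_one.trans hy1).ne'
  rw [Polynomial.eval₂_eq_sum_range, Finset.sum_range_succ, hp.coeff_natDegree, map_one,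
    one_mul, add_eq_zero_iff_eq_neg'] at hp0
  have hpos : p.natDegree ≠ 0 := by
    intro h0
    rw [h0] at hp0
    simp at hp0
  have hv : O.valuation (y ^ p.natDegree) < O.valuation (y ^ p.natDegree) := by
    conv_lhs => rw [hp0, Valuation.map_neg]
    refine O.valuation.map_sum_lt (by rw [map_pow]; exact pow_ne_zero _ hy0) fun i hi => ?_
    have hi' := Finset.mem_range.1 hi
    change O.valuation ((p.coeff i : L) * _) < _
    rw [← hq i, map_mul, map_pow, map_pow]
    have h1 : O.valuation (Polynomial.aeval s (q i)) < O.valuation y :=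
      (valuation_aeval_le O hO s (q i)
        (Finset.le_sup (f := fun i => (q i).natDegree) hi)).trans_lt hlt
    calc _ < O.valuation y * O.valuation y ^ i := by
          refine mul_lt_mul_of_pos_right h1 (pow_pos (zero_lt_one.trans hy1) i)
      _ = O.valuation y ^ (i + 1) := by rw [pow_succ']
      _ ≤ _ := pow_le_pow_right' hy1.le hi'
  exact lt_irrefl _ hv

end Poles

section Rank
attribute [local instance] MvPolynomial.algebraMvPolynomial

variable {k L T σ : Type} [Field k] [Field L] [Algebra k L] [Field T]
  [Algebra (MvPolynomial σ k) T]

lemma coeff_algebraMap_mul_C (a : MvPolynomial σ k) (z : L) (i : σ →₀ ℕ) :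
    (a • (MvPolynomial.C z : MvPolynomial σ L)).coeff i = a.coeff i • z := by
  rw [Algebra.smul_def, MvPolynomial.algebraMap_def, mul_comm, MvPolynomial.coeff_C_mul,
    MvPolynomial.coeff_map, Algebra.smul_def, mul_comm]

lemma mem_span_C_of_coeff_mem {A : Submodule k L} {H : MvPolynomial σ L}
    (hH : ∀ j, H.coeff j ∈ A) :
    H ∈ Submodule.span (MvPolynomial σ k) (MvPolynomial.C '' (A : Set L)) := by
  rw [H.as_sum]
  refine Submodule.sum_mem _ fun j _ => ?_
  have : MvPolynomial.monomial j (H.coeff j)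
      = (MvPolynomial.monomial j (1 : k)) • (MvPolynomial.C (H.coeff j) : MvPolynomial σ L) := by
    rw [Algebra.smul_def, MvPolynomial.algebraMap_def, MvPolynomial.map_monomial, map_one, mul_comm,
      MvPolynomial.C_mul_monomial, mul_one]
  rw [this]
  exact Submodule.smul_mem _ _ (Submodule.subset_span ⟨_, hH j, rfl⟩)

lemma rank_span_C_le (A : Submodule k L) [FiniteDimensional k A] :
    Module.rank (MvPolynomial σ k) (Submodule.span (MvPolynomial σ k)
      ((MvPolynomial.C : L → MvPolynomial σ L) '' (A : Set L))) ≤ Module.finrank k A := by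
  let b := Module.finBasis k A
  have h : Submodule.span (MvPolynomial σ k)
      ((MvPolynomial.C : L → MvPolynomial σ L) '' (A : Set L)) ≤
      Submodule.span (MvPolynomial σ k)
        (Set.range fun i => (MvPolynomial.C (b i : L) : MvPolynomial σ L)) := by
    rw [Submodule.span_le]
    rintro _ ⟨a, ha, rfl⟩
    have := b.sum_repr ⟨a, ha⟩
    have h2 : a = ∑ i, b.repr ⟨a, ha⟩ i • (b i : L) := by
      have h := congrArg (Submodule.subtype A) this
      rw [map_sum] at h
      exact h.symm
    rw [h2, map_sum]
    refine Submodule.sum_mem _ fun i _ => ?_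
    have : (MvPolynomial.C (b.repr ⟨a, ha⟩ i • (b i : L)) : MvPolynomial σ L)
        = (MvPolynomial.C (b.repr ⟨a, ha⟩ i) : MvPolynomial σ k) •
          (MvPolynomial.C (b i : L) : MvPolynomial σ L) := by
      rw [Algebra.smul_def, Algebra.smul_def, map_mul, MvPolynomial.algebraMap_def,
        MvPolynomial.map_C]
    rw [this]
    exact Submodule.smul_mem _ _ (Submodule.subset_span ⟨i, rfl⟩)
  refine (Submodule.rank_mono h).trans ((rank_span_le _).trans ?_)
  refine Cardinal.mk_range_le.trans ?_
  simp

lemma linearIndependent_C {m : ℕ} {z : Fin m → L} (hz : LinearIndependent k z) :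
    LinearIndependent (MvPolynomial σ k)
      (fun j => (MvPolynomial.C (z j) : MvPolynomial σ L)) := by
  rw [Fintype.linearIndependent_iff] at hz ⊢
  intro g hg j
  ext i
  refine hz (fun j => (g j).coeff i) ?_ j
  have := congrArg (MvPolynomial.coeff i) hg
  rw [MvPolynomial.coeff_sum] at this
  simpa only [coeff_algebraMap_mul_C, MvPolynomial.coeff_zero] using this

lemma card_le_of_dvd_of_mem_ker (π : MvPolynomial σ L →ₐ[MvPolynomial σ k] T)
    {F : MvPolynomial σ L} (hker : ∀ Z, π Z = 0 → F ∣ Z) {d : ℕ}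
    (hd : Module.rank (MvPolynomial σ k) T ≤ d) {m : ℕ} {z : Fin m → L}
    (hz : LinearIndependent k z) (A : Submodule k L) [FiniteDimensional k A]
    (hA : ∀ H : MvPolynomial σ L, (∀ i, (F * H).coeff i ∈ Submodule.span k (Set.range z)) →
      ∀ j, H.coeff j ∈ A) : m ≤ d + Module.finrank k A := by
  set M := Submodule.span (MvPolynomial σ k)
    (Set.range fun j => (MvPolynomial.C (z j) : MvPolynomial σ L)) with hM
  have hrM : Module.rank (MvPolynomial σ k) M = m := by
    rw [hM, rank_span (linearIndependent_C hz),
      Cardinal.mk_range_eq _ (linearIndependent_C hz).injective]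
    simp
  have hcoeff : ∀ Z ∈ M, ∀ i, Z.coeff i ∈ Submodule.span k (Set.range z) := by
    intro Z hZ i
    rw [hM, Submodule.mem_span_range_iff_exists_fun] at hZ
    obtain ⟨c, rfl⟩ := hZ
    rw [MvPolynomial.coeff_sum]
    refine Submodule.sum_mem _ fun j _ => ?_
    rw [coeff_algebraMap_mul_C]
    exact Submodule.smul_mem _ _ (Submodule.subset_span ⟨j, rfl⟩)
  let ψ : M →ₗ[MvPolynomial σ k] T := π.toLinearMap.domRestrict M
  have h1 := LinearMap.rank_range_add_rank_ker ψ
  have h2 : Module.rank (MvPolynomial σ k) (LinearMap.range ψ) ≤ d :=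
    (Submodule.rank_le _).trans hd
  set N := (Submodule.span (MvPolynomial σ k)
      ((MvPolynomial.C : L → MvPolynomial σ L) '' (A : Set L))).map
        (LinearMap.mulLeft (MvPolynomial σ k) F) with hN
  have h3 : Module.rank (MvPolynomial σ k) (LinearMap.ker ψ) ≤ Module.finrank k A := by
    have hle : (LinearMap.ker ψ).map M.subtype ≤ N := by
      rintro _ ⟨Z, hZ, rfl⟩
      obtain ⟨H, hH⟩ := hker Z hZ
      refine ⟨H, mem_span_C_of_coeff_mem (hA H fun i => ?_), hH.symm⟩
      rw [← hH]
      exact hcoeff _ Z.2 i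
    calc _ = Module.rank (MvPolynomial σ k) ((LinearMap.ker ψ).map M.subtype) :=
          (LinearEquiv.rank_eq (Submodule.equivMapOfInjective _ M.injective_subtype _))
      _ ≤ Module.rank (MvPolynomial σ k) N := Submodule.rank_mono hle
      _ ≤ _ := (rank_map_le _ _).trans (rank_span_C_le A)
  rw [hrM] at h1
  have : (m : Cardinal) ≤ ((d + Module.finrank k A : ℕ) : Cardinal) := by
    rw [← h1, Nat.cast_add]
    exact add_le_add h2 h3
  exact_mod_cast this

end Rank

section Degree
attribute [local instance] MvPolynomial.algebraMvPolynomial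

variable {k L T σ : Type} [Field k] [Field L] [Algebra k L] [Field T]
  [Algebra (MvPolynomial σ k) T]

lemma coeff_mem_poleSpace_of_mul {F H : MvPolynomial σ L} {s : L} {n : ℕ}
    (h1 : (1 : L) ∈ Submodule.span k (Set.range fun i => F.coeff i))
    (hs : s ∈ Submodule.span k (Set.range fun i => F.coeff i))
    (hFH : ∀ i, (F * H).coeff i ∈ poleSpace k s (n + 1)) (j : σ →₀ ℕ) :
    H.coeff j ∈ poleSpace k s n := by
  intro O hO
  set γ := max 1 (O.valuation s) with hγ
  have hγ1 : 1 ≤ γ := le_max_left _ _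
  have key : ∀ x ∈ Submodule.span k (Set.range fun i => F.coeff i),
      O.valuation (x * H.coeff j) ≤ γ ^ (n + 1) := by
    intro x hx
    induction hx using Submodule.span_induction with
    | mem x hx =>
      obtain ⟨i, rfl⟩ := hx
      exact O.valuation_coeff_mul_coeff_le (fun m => hFH m O hO) i j
    | zero => simp
    | add x y _ _ hx hy =>
      rw [add_mul]
      exact (O.valuation.map_add _ _).trans (max_le hx hy)
    | smul c x _ hx =>
      rw [smul_mul_assoc, Algebra.smul_def, map_mul]
      exact (mul_le_mul' ((O.valuation_le_one_iff _).2 (hO c)) hx).trans_eq (one_mul _)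
  have h2 : γ * O.valuation (H.coeff j) ≤ γ * γ ^ n := by
    rw [← pow_succ']
    rcases max_choice 1 (O.valuation s) with h | h
    · have h3 := key 1 h1
      rw [one_mul] at h3
      refine le_trans (le_of_eq ?_) h3
      rw [hγ, h, one_mul]
    · have h3 := key s hs
      rw [map_mul] at h3
      refine le_trans (le_of_eq ?_) h3
      rw [hγ, h]
  exact le_of_mul_le_mul_left h2 (zero_lt_one.trans_le hγ1)

lemma finrank_poleSpace_le [IsAlgClosed k] (π : MvPolynomial σ L →ₐ[MvPolynomial σ k] T)
    {F : MvPolynomial σ L} (hker : ∀ Z, π Z = 0 → F ∣ Z) {d : ℕ}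
    (hd : Module.rank (MvPolynomial σ k) T ≤ d) {s : L}
    (h1 : (1 : L) ∈ Submodule.span k (Set.range fun i => F.coeff i))
    (hs : s ∈ Submodule.span k (Set.range fun i => F.coeff i)) (n : ℕ) :
    FiniteDimensional k (poleSpace k s n) ∧ Module.finrank k (poleSpace k s n) ≤ 1 + n * d := by
  have aux : ∀ (V : Submodule k L) (N : ℕ), Module.rank k V ≤ N →
      FiniteDimensional k V ∧ Module.finrank k V ≤ N := fun V N h =>
    ⟨Module.rank_lt_aleph0_iff.1 (h.trans_lt Cardinal.natCast_lt_aleph0),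
      Module.finrank_le_of_rank_le h⟩
  induction n with
  | zero =>
    refine aux _ _ ?_
    have hle : poleSpace k s 0 ≤ Submodule.span k {(1 : L)} := fun y hy => by
      have hi := isIntegral_of_mem_poleSpace_zero hy
      obtain ⟨c, rfl⟩ := minpoly.mem_range_of_degree_eq_one k y
        (IsAlgClosed.degree_eq_one_of_irreducible k (minpoly.irreducible hi))
      rw [Algebra.algebraMap_eq_smul_one]
      exact Submodule.smul_mem _ _ (Submodule.mem_span_singleton_self _)
    refine (Submodule.rank_mono hle).trans ((rank_span_le _).trans ?_)
    simp
  | succ n ih =>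
    obtain ⟨hfin, hrank⟩ := ih
    refine aux _ _ (rank_le fun t ht => ?_)
    have hz : LinearIndependent k
        (fun i : Fin t.card => ((t.equivFin.symm i : poleSpace k s (n + 1)) : L)) :=
      (ht.map' (poleSpace k s (n + 1)).subtype (Submodule.ker_subtype _)).comp _
        t.equivFin.symm.injective
    have := card_le_of_dvd_of_mem_ker π hker hd hz (poleSpace k s n) (fun H hH =>
      coeff_mem_poleSpace_of_mul h1 hs fun i => by
        refine (Submodule.span_le.2 ?_) (hH i)
        rintro _ ⟨j, rfl⟩
        exact Subtype.prop _)
    rw [add_mul]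
    omega

lemma card_le_of_linearIndependent [IsAlgClosed k] (π : MvPolynomial σ L →ₐ[MvPolynomial σ k] T)
    {F : MvPolynomial σ L} (hker : ∀ Z, π Z = 0 → F ∣ Z) {d : ℕ}
    (hd : Module.rank (MvPolynomial σ k) T ≤ d) {s : L}
    (h1 : (1 : L) ∈ Submodule.span k (Set.range fun i => F.coeff i))
    (hs : s ∈ Submodule.span k (Set.range fun i => F.coeff i))
    (htr : Transcendental k s) [Algebra.IsAlgebraic (Algebra.adjoin k ({s} : Set L)) L]
    (M : IntermediateField k L) (hsM : s ∈ M)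
    {e : ℕ} {y : Fin e → L} (hy : LinearIndependent M y) : e ≤ d := by
  have hadj : ∀ r ∈ Algebra.adjoin k ({s} : Set L), r ∈ M := by
    intro r hr
    induction hr using Algebra.adjoin_induction with
    | mem x hx => rwa [Set.mem_singleton_iff.1 hx]
    | algebraMap c =>
      rw [IsScalarTower.algebraMap_apply k M L]
      exact (algebraMap k M c).2
    | add x y _ _ hx hy => exact add_mem hx hy
    | mul x y _ _ hx hy => exact mul_mem hx hy
  have hsc : ∀ j, ∃ r : Mˣ, ∃ c, r • y j ∈ poleSpace k s c := by
    intro j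
    obtain ⟨r, hr, hi⟩ := (Algebra.IsAlgebraic.isAlgebraic
      (R := Algebra.adjoin k ({s} : Set L)) (y j)).exists_integral_multiple
    obtain ⟨c, hc⟩ := exists_mem_poleSpace_of_isIntegral hi
    exact ⟨Units.mk0 ⟨r, hadj _ r.2⟩
      (fun h => hr (Subtype.ext (congrArg (fun z : M => (z : L)) h))), c, hc⟩
  choose r c hrc using hsc
  set C := Finset.univ.sup c
  have hy' : LinearIndependent M (fun j => r j • y j) := hy.units_smul r
  have hpow : LinearIndependent k (fun i : ℕ => (⟨s, hsM⟩ : M) ^ i) := by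
    refine LinearIndependent.of_comp (IsScalarTower.toAlgHom k M L).toLinearMap ?_
    have h := (Polynomial.basisMonomials k).linearIndependent.map' (Polynomial.aeval s).toLinearMap
      (LinearMap.ker_eq_bot.2 (transcendental_iff_injective.1 htr))
    have h' : LinearIndependent k (fun i : ℕ => s ^ i) := by
      simpa [Function.comp_def, Polynomial.aeval_monomial] using h
    exact h'
  by_contra! hlt
  have hb : ∀ N, N * e ≤ 1 + (N + C) * d := by
    intro N
    obtain ⟨hfin, hrank⟩ := finrank_poleSpace_le π hker hd h1 hs (N + C)
    have hli := linearIndependent_smul (hpow.comp (fun i : Fin N => (i : ℕ)) Fin.val_injective) hy'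
    have hmem : ∀ p : Fin N × Fin e,
        ((⟨s, hsM⟩ : M) ^ (p.1 : ℕ)) • (r p.2 • y p.2) ∈ poleSpace k s (N + C) := by
      intro p
      have h2 := aeval_mul_mem_poleSpace
        (poleSpace_mono (Finset.le_sup (Finset.mem_univ p.2)) (hrc p.2))
        (Polynomial.X ^ (p.1 : ℕ)) (n := N) (by rw [Polynomial.natDegree_X_pow]; exact p.1.2.le)
      rw [map_pow, Polynomial.aeval_X] at h2
      exact h2
    have hli' : LinearIndependent k
        (fun p : Fin N × Fin e => (⟨_, hmem p⟩ : poleSpace k s (N + C))) :=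
      LinearIndependent.of_comp (poleSpace k s (N + C)).subtype hli
    have := hli'.fintype_card_le_finrank
    simp only [Fintype.card_prod, Fintype.card_fin] at this
    omega
  have h3 := hb (2 + C * d)
  have h4 : (2 + C * d) * (d + 1) ≤ (2 + C * d) * e := Nat.mul_le_mul_left _ hlt
  nlinarith

end Degree

section Principal
attribute [local instance] MvPolynomial.algebraMvPolynomial

variable {k L T σ : Type} [Field k] [Field L] [Algebra k L]

lemma isAlgebraic_of_map_C_mem {B : Type} [CommRing B] [IsDomain B] [Algebra (MvPolynomial σ k) B]
    (τ : MvPolynomial σ L →ₐ[MvPolynomial σ k] B) (hτ : Function.Surjective τ) {t : L}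
    [Algebra.IsAlgebraic (Algebra.adjoin k ({t} : Set L)) L] (A : Subalgebra (MvPolynomial σ k) B)
    (ht : τ (MvPolynomial.C t) ∈ A) : Algebra.IsAlgebraic A B := by
  let j : L →+* B := (τ : MvPolynomial σ L →+* B).comp MvPolynomial.C
  have hjk : ∀ c : k,
      j (algebraMap k L c) = algebraMap (MvPolynomial σ k) B (MvPolynomial.C c) := by
    intro c
    have := τ.commutes (MvPolynomial.C c)
    rw [MvPolynomial.algebraMap_def, MvPolynomial.map_C] at this
    exact this
  have hj : ∀ r : Algebra.adjoin k ({t} : Set L), j r ∈ A := by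
    rintro ⟨r, hr⟩
    change j r ∈ A
    induction hr using Algebra.adjoin_induction with
    | mem x hx => rwa [Set.mem_singleton_iff.1 hx]
    | algebraMap c => rw [hjk]; exact A.algebraMap_mem _
    | add x y _ _ hx hy => rw [map_add]; exact add_mem hx hy
    | mul x y _ _ hx hy => rw [map_mul]; exact mul_mem hx hy
  let f : Algebra.adjoin k ({t} : Set L) →+* A :=
    (j.comp (Algebra.adjoin k ({t} : Set L)).val.toRingHom).codRestrict A hj
  have hC : ∀ l : L, IsAlgebraic A (τ (MvPolynomial.C l)) := by
    intro l
    refine (Algebra.IsAlgebraic.isAlgebraic (R := Algebra.adjoin k ({t} : Set L))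
      l).ringHom_of_comp_eq
      f j ?_ ?_
    · intro x y hxy
      exact Subtype.ext (j.injective (congrArg Subtype.val hxy))
    · rfl
  refine ⟨fun b => ?_⟩
  obtain ⟨P, rfl⟩ := hτ b
  induction P using MvPolynomial.induction_on with
  | C l => exact hC l
  | add p q hp hq => rw [map_add]; exact hp.add hq
  | mul_X p i hp =>
    rw [map_mul]
    refine hp.mul ?_
    have : τ (MvPolynomial.X i) = algebraMap A B ⟨_, A.algebraMap_mem (MvPolynomial.X i)⟩ := by
      have := τ.commutes (MvPolynomial.X i)
      rw [MvPolynomial.algebraMap_def, MvPolynomial.map_X] at this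
      exact this
    rw [this]
    exact isAlgebraic_algebraMap _

variable [Field T] [Algebra (MvPolynomial σ k) T]

lemma dvd_of_mem_ker_of_prime (hT : Function.Injective (algebraMap (MvPolynomial σ k) T))
    (π : MvPolynomial σ L →ₐ[MvPolynomial σ k] T) {t : L}
    [Algebra.IsAlgebraic (Algebra.adjoin k ({t} : Set L)) L]
    {F : MvPolynomial σ L} (hF : Prime F) (hπ : π F = 0) {Z : MvPolynomial σ L} (hZ : π Z = 0) :
    F ∣ Z := by
  have h0 : ∀ a : MvPolynomial σ k, F ∣ algebraMap _ (MvPolynomial σ L) a → a = 0 := by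
    rintro a ⟨H, hH⟩
    apply hT
    rw [← π.commutes, hH, map_mul, hπ, zero_mul, map_zero]
  have : (Ideal.span {F}).IsPrime := (Ideal.span_singleton_prime hF.ne_zero).2 hF
  let D := MvPolynomial σ L ⧸ Ideal.span {F}
  let mk : MvPolynomial σ L →ₐ[MvPolynomial σ k] D := Ideal.Quotient.mkₐ _ _
  have hmk : ∀ P, mk P = 0 ↔ F ∣ P := fun P => by
    rw [← Ideal.mem_span_singleton]
    exact Ideal.Quotient.eq_zero_iff_mem
  have hmks : Function.Surjective mk := Ideal.Quotient.mkₐ_surjective _ _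
  have halg : IsAlgebraic (MvPolynomial σ k) (mk (MvPolynomial.C t)) := by
    have := isAlgebraic_of_map_C_mem (AlgHom.id (MvPolynomial σ k) (MvPolynomial σ L))
      Function.surjective_id (t := t) (Algebra.adjoin _ {MvPolynomial.C t})
      (Algebra.subset_adjoin rfl)
    obtain ⟨⟨Q, hQ⟩, hQ0, hdvd⟩ := (this.isAlgebraic F).exists_nonzero_dvd
      (mem_nonZeroDivisors_of_ne_zero hF.ne_zero)
    rw [Algebra.adjoin_singleton_eq_range_aeval] at hQ
    obtain ⟨P, rfl⟩ := hQ
    refine ⟨P, ?_, ?_⟩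
    · rintro rfl
      exact hQ0 (Subtype.ext (map_zero _))
    · rw [Polynomial.aeval_algHom_apply, hmk]
      exact hdvd
  have := isAlgebraic_of_map_C_mem mk hmks (t := t)
    (Subalgebra.algebraicClosure (MvPolynomial σ k) D) halg
  have halgD : Algebra.IsAlgebraic (MvPolynomial σ k) D :=
    Algebra.IsAlgebraic.trans _ (Subalgebra.algebraicClosure (MvPolynomial σ k) D) _
  by_contra hn
  obtain ⟨r, hr, hdvd⟩ := (halgD.isAlgebraic (mk Z)).exists_nonzero_dvd
    (mem_nonZeroDivisors_of_ne_zero (fun h => hn ((hmk Z).1 h)))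
  obtain ⟨c, hc⟩ := hdvd
  obtain ⟨H, rfl⟩ := hmks c
  rw [← map_mul, ← mk.commutes, ← sub_eq_zero, ← map_sub, hmk] at hc
  obtain ⟨q, hq⟩ := hc
  have h2 := congrArg π hq
  rw [map_sub, map_mul, map_mul, hZ, hπ, zero_mul, zero_mul, sub_zero, π.commutes] at h2
  exact hr (hT (h2.trans (map_zero _).symm))

end Principal

section Action
attribute [local instance] MvPolynomial.algebraMvPolynomial

variable {k L T σ G : Type} [Field k] [Field L] [Algebra k L]

open scoped IntermediateField.algebraAdjoinAdjoin in
lemma DimLE.trdeg_le {d : ℕ} (h : DimLE k L d) : Algebra.trdeg k L ≤ d := by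
  obtain ⟨s, hs, halg⟩ := h
  have : Algebra.IsAlgebraic (Algebra.adjoin k (s : Set L)) L :=
    (IsFractionRing.comap_isAlgebraic_iff (K := IntermediateField.adjoin k (s : Set L))).2 halg
  refine (Algebra.IsAlgebraic.trdeg_le_cardinalMk k (s : Set L)).trans ?_
  simpa using hs

lemma DimLE.isAlgebraic_adjoin (h : DimLE k L 1) {s : L} (hs : Transcendental k s) :
    Algebra.IsAlgebraic (Algebra.adjoin k ({s} : Set L)) L := by
  have h1 : AlgebraicIndependent k ![s] := by
    rw [algebraicIndependent_unique_type_iff]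
    exact hs
  have h2 := (h1.isTranscendenceBasis_of_trdeg_le_of_finite (by simpa using h.trdeg_le)).isAlgebraic
  rwa [Matrix.range_cons, Matrix.range_empty, Set.union_empty] at h2

lemma card_le_of_forall_apply_eq [IsAlgClosed k] [Field T] [Algebra (MvPolynomial σ k) T]
    (π : MvPolynomial σ L →ₐ[MvPolynomial σ k] T)
    {F : MvPolynomial σ L} (hker : ∀ Z, π Z = 0 → F ∣ Z) {d : ℕ}
    (hd : Module.rank (MvPolynomial σ k) T ≤ d) (hdim : DimLE k L 1) {a b : L}
    (ha : a ∈ Submodule.span k (Set.range fun i => F.coeff i))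
    (hb : b ∈ Submodule.span k (Set.range fun i => F.coeff i))
    (hab : LinearIndependent k ![a, b]) (H : Subgroup (L ≃ₐ[k] L)) [Finite H]
    (hH : ∀ h ∈ H, h (a / b) = a / b) : Nat.card H ≤ d := by
  have := Fintype.ofFinite H
  have hb0 : b ≠ 0 := hab.ne_zero 1
  have hcoef : ∀ x ∈ Submodule.span k (Set.range fun i => F.coeff i),
      b⁻¹ * x ∈ Submodule.span k
        (Set.range fun i => (MvPolynomial.C b⁻¹ * F).coeff i) := by
    intro x hx
    have := Submodule.mem_map_of_mem (f := LinearMap.mulLeft k b⁻¹) hx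
    rw [Submodule.map_span, ← Set.range_comp] at this
    simpa only [Function.comp_def, LinearMap.mulLeft_apply, MvPolynomial.coeff_C_mul] using this
  have htr : Transcendental k (a / b) := by
    intro hal
    obtain ⟨c, hc⟩ := minpoly.mem_range_of_degree_eq_one k (a / b)
        (IsAlgClosed.degree_eq_one_of_irreducible k (minpoly.irreducible hal.isIntegral))
    rw [LinearIndependent.pair_iff] at hab
    have := (hab 1 (-c) (by
      rw [one_smul, neg_smul, Algebra.smul_def, hc, div_mul_cancel₀ _ hb0, add_neg_cancel])).1
    exact one_ne_zero this
  have := hdim.isAlgebraic_adjoin htr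
  have hfr : Module.finrank (FixedPoints.intermediateField H : IntermediateField k L) L
      = Fintype.card H := FixedPoints.finrank_eq_card H L
  have : FiniteDimensional (FixedPoints.intermediateField H : IntermediateField k L) L :=
    Module.finite_of_finrank_pos (by rw [hfr]; exact Fintype.card_pos)
  rw [Nat.card_eq_fintype_card, ← hfr]
  refine card_le_of_linearIndependent (F := MvPolynomial.C b⁻¹ * F) π (fun Z hZ => ?_) hd
    (s := a / b) ?_ ?_ htr (FixedPoints.intermediateField H) (fun h => hH h.1 h.2)
    (Module.finBasis (FixedPoints.intermediateField H : IntermediateField k L) L).linearIndependent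
  · obtain ⟨Q, rfl⟩ := hker Z hZ
    exact ⟨MvPolynomial.C b * Q, by
      rw [mul_mul_mul_comm, ← map_mul, inv_mul_cancel₀ hb0, map_one, one_mul]⟩
  · simpa [hb0] using hcoef b hb
  · simpa [div_eq_inv_mul] using hcoef a ha

variable [Group G] [MulAction G σ]

/-- The action of `g` on polynomials over `L` which acts on the coefficients via `α` and
permutes the variables. -/
noncomputable def mvPolynomialAct (α : G →* (L ≃ₐ[k] L)) (g : G) :
    MvPolynomial σ L →+* MvPolynomial σ L :=
  (MvPolynomial.rename (R := L) (fun i : σ => g • i)).toRingHom.comp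
    (MvPolynomial.map (α g : L →+* L))

lemma mvPolynomialAct_C (α : G →* (L ≃ₐ[k] L)) (g : G) (a : L) :
    mvPolynomialAct α g (MvPolynomial.C a : MvPolynomial σ L) = MvPolynomial.C (α g a) := by
  simp [mvPolynomialAct]

lemma mvPolynomialAct_X (α : G →* (L ≃ₐ[k] L)) (g : G) (i : σ) :
    mvPolynomialAct α g (MvPolynomial.X i : MvPolynomial σ L) = MvPolynomial.X (g • i) := by
  simp [mvPolynomialAct]

lemma mvPolynomialAct_mul (α : G →* (L ≃ₐ[k] L)) (g h : G) (P : MvPolynomial σ L) :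
    mvPolynomialAct α (g * h) P = mvPolynomialAct α g (mvPolynomialAct α h P) := by
  induction P using MvPolynomial.induction_on with
  | C a => simp [mvPolynomialAct_C]
  | add p q hp hq => simp [hp, hq]
  | mul_X p i hp => simp [hp, mvPolynomialAct_X, mul_smul]

lemma mvPolynomialAct_one (α : G →* (L ≃ₐ[k] L)) (P : MvPolynomial σ L) :
    mvPolynomialAct α 1 P = P := by
  induction P using MvPolynomial.induction_on with
  | C a => simp [mvPolynomialAct_C]
  | add p q hp hq => simp [hp, hq]
  | mul_X p i hp => simp [hp, mvPolynomialAct_X]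

lemma coeff_mvPolynomialAct (α : G →* (L ≃ₐ[k] L)) (g : G) (P : MvPolynomial σ L) (i : σ →₀ ℕ) :
    (mvPolynomialAct α g P).coeff (i.mapDomain (g • ·)) = α g (P.coeff i) := by
  change (MvPolynomial.rename _ _).coeff _ = _
  rw [MvPolynomial.coeff_rename_mapDomain _ (MulAction.injective g)]
  exact MvPolynomial.coeff_map _ _ _

variable [Field T] [Algebra (MvPolynomial σ k) T]

/-- A prime generator of the kernel can be rescaled to be invariant under the group. -/
lemma exists_invariant_of_prime [Fintype G] {α : G →* (L ≃ₐ[k] L)} (hα : Function.Injective α)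
    (π : MvPolynomial σ L →ₐ[MvPolynomial σ k] T)
    (hπ : ∀ g P, π P = 0 → π (mvPolynomialAct α g P) = 0) {F : MvPolynomial σ L} (hF : Prime F)
    (hF0 : π F = 0) (hker : ∀ Z, π Z = 0 → F ∣ Z) :
    ∃ F' : MvPolynomial σ L, F' ≠ 0 ∧ π F' = 0 ∧ (∀ Z, π Z = 0 → F' ∣ Z) ∧
      ∀ g, mvPolynomialAct α g F' = F' := by
  have hc : ∀ g, ∃ c : L, c ≠ 0 ∧ mvPolynomialAct α g F = MvPolynomial.C c * F := by
    intro g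
    have h1 : F ∣ mvPolynomialAct α g F := hker _ (hπ g _ hF0)
    have h2 : mvPolynomialAct α g F ∣ F := by
      have := map_dvd (mvPolynomialAct α g) (hker _ (hπ g⁻¹ _ hF0))
      rwa [← mvPolynomialAct_mul, mul_inv_cancel, mvPolynomialAct_one] at this
    obtain ⟨u, hu⟩ := associated_of_dvd_dvd h1 h2
    obtain ⟨r, hr, hur⟩ := MvPolynomial.isUnit_iff_eq_C_of_isReduced.1 u.isUnit
    exact ⟨r, hr.ne_zero, by rw [← hu, hur, mul_comm]⟩
  choose c hc0 hc using hc
  have hμ : ∃ l : L, ∑ g, c g * α g l ≠ 0 := by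
    by_contra! h
    have hli : LinearIndependent L (fun (g : G) (l : L) => α g l) :=
      (linearIndependent_monoidHom L L).comp (fun g : G => ((α g : L →+* L) : L →* L))
        (fun g h hgh => hα (AlgEquiv.ext fun l => DFunLike.congr_fun hgh l))
    rw [Fintype.linearIndependent_iff] at hli
    refine hc0 1 (hli c ?_ 1)
    ext l
    simpa using h l
  obtain ⟨l, hl⟩ := hμ
  have hsum : ∑ g, mvPolynomialAct α g (MvPolynomial.C l * F)
      = MvPolynomial.C (∑ g, c g * α g l) * F := by
    rw [map_sum, Finset.sum_mul]
    refine Finset.sum_congr rfl fun g _ => ?_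
    rw [map_mul, mvPolynomialAct_C, hc, ← mul_assoc, ← map_mul, mul_comm (c g)]
  refine ⟨∑ g, mvPolynomialAct α g (MvPolynomial.C l * F), ?_, ?_, fun Z hZ => ?_, fun g => ?_⟩
  · rw [hsum]
    exact mul_ne_zero (fun h => hl (MvPolynomial.C_eq_zero.1 h)) hF.ne_zero
  · rw [hsum, map_mul, hF0, mul_zero]
  · obtain ⟨Q, rfl⟩ := hker Z hZ
    rw [hsum]
    exact ⟨MvPolynomial.C (∑ g, c g * α g l)⁻¹ * Q, by
      rw [mul_mul_mul_comm, ← map_mul, mul_inv_cancel₀ hl, map_one, one_mul]⟩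
  · rw [map_sum]
    simp_rw [← mvPolynomialAct_mul]
    exact Fintype.sum_equiv (Equiv.mulLeft g) _ _ fun h => rfl

/-- The coefficients of an invariant generator of the kernel span a stable subspace of `L` of
dimension at least two. -/
theorem exists_stable_submodule [IsAlgClosed k] [Finite G] {α : G →* (L ≃ₐ[k] L)}
    (hα : Function.Injective α) (hdim : DimLE k L 1) {t : L} (ht : Transcendental k t)
    (hT : Function.Injective (algebraMap (MvPolynomial σ k) T))
    (π : MvPolynomial σ L →ₐ[MvPolynomial σ k] T)
    (hπ : ∀ g P, π P = 0 → π (mvPolynomialAct α g P) = 0) {d : ℕ}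
    (hd : Module.rank (MvPolynomial σ k) T ≤ d) :
    ∃ S : Submodule k L, FiniteDimensional k S ∧ 2 ≤ Module.finrank k S ∧
      (∀ g, ∀ x ∈ S, α g x ∈ S) ∧
      ∀ a ∈ S, ∀ b ∈ S, LinearIndependent k ![a, b] → ∀ H : Subgroup G,
        (∀ h ∈ H, α h (a / b) = a / b) → Nat.card H ≤ d := by
  have := Fintype.ofFinite G
  have hne : RingHom.ker π ≠ ⊥ := by
    intro h
    have hinj : LinearMap.ker π.toLinearMap = ⊥ :=
      LinearMap.ker_eq_bot.2 ((RingHom.injective_iff_ker_eq_bot π).2 h)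
    have hpow : LinearIndependent k (fun i : ℕ => t ^ i) := by
      have h := (Polynomial.basisMonomials k).linearIndependent.map'
        (Polynomial.aeval t).toLinearMap
        (LinearMap.ker_eq_bot.2 (transcendental_iff_injective.1 ht))
      simpa [Function.comp_def, Polynomial.aeval_monomial] using h
    have hli := ((linearIndependent_C (σ := σ) (hpow.comp (fun i : Fin (d + 1) => (i : ℕ))
      Fin.val_injective)).map' _ hinj).cardinal_le_rank
    have := hli.trans hd
    rw [Cardinal.mk_fin] at this
    have : d + 1 ≤ d := by exact_mod_cast this
    omega
  have hprime : (RingHom.ker π).IsPrime := RingHom.ker_isPrime _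
  obtain ⟨F, hFmem, hF⟩ := hprime.exists_mem_prime_of_ne_bot hne
  have := hdim.isAlgebraic_adjoin ht
  obtain ⟨F, hF0, hFπ, hker, hinv⟩ := exists_invariant_of_prime hα π hπ hF hFmem
    (fun Z hZ => dvd_of_mem_ker_of_prime hT π (t := t) hF hFmem hZ)
  set S := Submodule.span k (Set.range fun i => F.coeff i) with hS
  have hfd : FiniteDimensional k S := by
    refine FiniteDimensional.span_of_finite k ?_
    refine ((F.support.finite_toSet.image fun i => F.coeff i).union
      (Set.finite_singleton 0)).subset ?_
    rintro _ ⟨i, rfl⟩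
    by_cases hi : i ∈ F.support
    · exact Or.inl ⟨i, hi, rfl⟩
    · exact Or.inr (MvPolynomial.notMem_support_iff.1 hi)
  refine ⟨S, hfd, ?_, ?_, ?_⟩
  · by_contra! hlt
    obtain ⟨s, hs⟩ := finrank_le_one_iff.1 (Nat.lt_succ_iff.1 hlt)
    have hle : S ≤ Submodule.span k {(s : L)} := by
      intro x hx
      obtain ⟨c, hc⟩ := hs ⟨x, hx⟩
      exact Submodule.mem_span_singleton.2 ⟨c, congrArg Subtype.val hc⟩
    have hmem : F ∈ Submodule.span (MvPolynomial σ k)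
        {(MvPolynomial.C (s : L) : MvPolynomial σ L)} := by
      have h1 := mem_span_C_of_coeff_mem (A := Submodule.span k {(s : L)}) (H := F)
        (fun j => hle (Submodule.subset_span ⟨j, rfl⟩))
      refine (Submodule.span_le.2 ?_) h1
      rintro _ ⟨x, hx, rfl⟩
      obtain ⟨c, rfl⟩ := Submodule.mem_span_singleton.1 hx
      refine Submodule.mem_span_singleton.2 ⟨MvPolynomial.C c, ?_⟩
      rw [Algebra.smul_def, Algebra.smul_def, map_mul, MvPolynomial.algebraMap_def,
        MvPolynomial.map_C]
    obtain ⟨a, ha⟩ := Submodule.mem_span_singleton.1 hmem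
    rw [← ha, map_smul, Algebra.smul_def, mul_eq_zero] at hFπ
    rcases hFπ with h | h
    · rw [hT (h.trans (map_zero _).symm), zero_smul] at ha
      exact hF0 ha.symm
    · have hs0 : (s : L) = 0 := by
        by_contra h0
        have : π (MvPolynomial.C (s : L)⁻¹ * MvPolynomial.C (s : L)) = 0 := by
          rw [map_mul, h, mul_zero]
        rw [← map_mul, inv_mul_cancel₀ h0, map_one, map_one] at this
        exact one_ne_zero this
      rw [hs0, map_zero, smul_zero] at ha
      exact hF0 ha.symm
  · intro g x hx
    have hle : S ≤ S.comap (α g).toLinearMap := by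
      rw [hS, Submodule.span_le]
      rintro _ ⟨i, rfl⟩
      refine Submodule.subset_span ⟨i.mapDomain (g • ·), ?_⟩
      change F.coeff _ = α g (F.coeff i)
      rw [← coeff_mvPolynomialAct, hinv]
    exact hle hx
  · intro a ha b hb hab H hH
    have : Finite (H.map α) := ((Set.toFinite (H : Set G)).image α).to_subtype
    rw [← Subgroup.card_map_of_injective hα]
    refine card_le_of_forall_apply_eq π hker hd hdim ha hb hab (H.map α) ?_
    rintro _ ⟨h, hh, rfl⟩
    exact hH h hh

end Action

section Permutation

variable (k G σ : Type) [Field k] [Group G] [MulAction G σ]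

/-- The action of `G` on polynomials by permutation of the variables. -/
noncomputable def mvPolynomialPerm : G →* (MvPolynomial σ k ≃ₐ[k] MvPolynomial σ k) where
  toFun g := MvPolynomial.renameEquiv k (MulAction.toPerm g)
  map_one' := by
    refine AlgEquiv.coe_toAlgHom_injective (MvPolynomial.algHom_ext fun i => ?_)
    simp
  map_mul' g h := by
    refine AlgEquiv.coe_toAlgHom_injective (MvPolynomial.algHom_ext fun i => ?_)
    simp [mul_smul]

/-- The action of `G` on rational functions by permutation of the variables. -/
noncomputable def fractionRingPerm :
    G →* (FractionRing (MvPolynomial σ k) ≃ₐ[k] FractionRing (MvPolynomial σ k)) :=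
  (IsFractionRing.fieldEquivOfAlgEquivHom k (FractionRing (MvPolynomial σ k))).comp
    (mvPolynomialPerm k G σ)

variable {k G σ} in
lemma fractionRingPerm_X (g : G) (i : σ) :
    fractionRingPerm k G σ g (algebraMap (MvPolynomial σ k) _ (MvPolynomial.X i)) =
      algebraMap (MvPolynomial σ k) _ (MvPolynomial.X (g • i)) := by
  simp [fractionRingPerm, mvPolynomialPerm]

/-- Affine space with coordinates permuted by `G`. -/
noncomputable def permGVariety [Finite σ] [FaithfulSMul G σ] : GVariety k G where
  K := FractionRing (MvPolynomial σ k)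
  fg := by
    classical
    have := Fintype.ofFinite σ
    let X' : σ → FractionRing (MvPolynomial σ k) := fun i =>
      algebraMap (MvPolynomial σ k) (FractionRing (MvPolynomial σ k)) (MvPolynomial.X i)
    refine ⟨Finset.univ.image X', ?_⟩
    rw [eq_top_iff]
    have h : ∀ P, algebraMap (MvPolynomial σ k) (FractionRing (MvPolynomial σ k)) P ∈
        IntermediateField.adjoin k ((Finset.univ.image X' : Finset _) : Set _) := by
      intro P
      induction P using MvPolynomial.induction_on with
      | C a =>
        rw [← MvPolynomial.algebraMap_eq, ← IsScalarTower.algebraMap_apply]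
        exact IntermediateField.algebraMap_mem _ a
      | add p q hp hq =>
        rw [map_add]
        exact add_mem hp hq
      | mul_X p i hp =>
        rw [map_mul]
        exact mul_mem hp (IntermediateField.subset_adjoin _ _ (by simp [X']))
    rintro x -
    obtain ⟨p, q, -, rfl⟩ := IsFractionRing.div_surjective (MvPolynomial σ k) x
    exact div_mem (h p) (h q)
  action := fractionRingPerm k G σ
  faithful := by
    refine (IsFractionRing.fieldEquivOfAlgEquivHom_injective k (MvPolynomial σ k) k
      (FractionRing (MvPolynomial σ k))).comp fun g h hgh => ?_
    refine FaithfulSMul.eq_of_smul_eq_smul fun i : σ => ?_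
    simpa [mvPolynomialPerm] using DFunLike.congr_fun hgh (MvPolynomial.X i)

attribute [local instance] MvPolynomial.algebraMvPolynomial

lemma rank_le_of_finrank_fieldRange_le {R K T : Type} [CommRing R] [IsDomain R]
    [Field K] [Field T] [Algebra R K] [IsFractionRing R K] [Algebra k K] [Algebra k T]
    [Algebra R T] (ι : K →ₐ[k] T) (hι : ∀ r, algebraMap R T r = ι (algebraMap R K r)) {d : ℕ}
    [FiniteDimensional ι.fieldRange T] (hd : Module.finrank ι.fieldRange T ≤ d) :
    Module.rank R T ≤ d := by
  let := (ι : K →+* T).toAlgebra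
  have hst : IsScalarTower R K T := IsScalarTower.of_algebraMap_eq hι
  have : FiniteDimensional K T :=
    Module.Finite.of_equiv_equiv ι.equivFieldRange.symm.toRingEquiv (RingEquiv.refl T) (by
      ext x
      obtain ⟨y, rfl⟩ := ι.equivFieldRange.surjective x
      simp [RingHom.algebraMap_toAlgebra])
  have h2 : Module.finrank K T = Module.finrank ι.fieldRange T :=
    Algebra.finrank_eq_of_equiv_equiv ι.equivFieldRange.toRingEquiv (RingEquiv.refl T) (by
      ext x
      rfl)
  refine rank_le fun s hs => ?_
  have := ((LinearIndependent.iff_fractionRing R K).1 hs).fintype_card_le_finrank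
  simp only [Fintype.card_coe] at this
  omega

variable {k G σ}

lemma exists_stable_submodule_of_cover [IsAlgClosed k] [Finite G] [Nontrivial G]
    {T Y : GVariety k G} {d : ℕ} (hdim : DimLE k Y.K 1)
    (ι : FractionRing (MvPolynomial σ k) →ₐ[k] T.K) (hfin : FiniteDimensional ι.fieldRange T.K)
    (hd : Module.finrank ι.fieldRange T.K ≤ d)
    (hι : ∀ g x, T.action g (ι x) = ι (fractionRingPerm k G σ g x))
    (φ : Y.K →ₐ[k] T.K) (hφ : ∀ g y, T.action g (φ y) = φ (Y.action g y)) :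
    ∃ S : Submodule k Y.K, FiniteDimensional k S ∧ 2 ≤ Module.finrank k S ∧
      (∀ g, ∀ x ∈ S, Y.action g x ∈ S) ∧
      ∀ a ∈ S, ∀ b ∈ S, LinearIndependent k ![a, b] → ∀ H : Subgroup G,
        (∀ h ∈ H, Y.action h (a / b) = a / b) → Nat.card H ≤ d := by
  have ht : ∃ t : Y.K, Transcendental k t := by
    by_contra! hn
    obtain ⟨g, hg⟩ := exists_ne (1 : G)
    refine hg (Y.faithful (AlgEquiv.ext fun y => ?_))
    obtain ⟨c, rfl⟩ := minpoly.mem_range_of_degree_eq_one k y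
        (IsAlgClosed.degree_eq_one_of_irreducible k
          (minpoly.irreducible (not_not.1 (hn y)).isIntegral))
    rw [AlgEquiv.commutes, AlgEquiv.commutes]
  obtain ⟨t, ht⟩ := ht
  let X' : MvPolynomial σ k →ₐ[k] FractionRing (MvPolynomial σ k) :=
    IsScalarTower.toAlgHom k (MvPolynomial σ k) (FractionRing (MvPolynomial σ k))
  let : Algebra (MvPolynomial σ k) T.K := ((ι.comp X' : _ →ₐ[k] T.K) : _ →+* T.K).toAlgebra
  let π : MvPolynomial σ Y.K →ₐ[MvPolynomial σ k] T.K :=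
    { MvPolynomial.eval₂Hom (φ : Y.K →+* T.K) (fun i => ι (X' (MvPolynomial.X i))) with
      commutes' := fun r => by
        change MvPolynomial.eval₂Hom (φ : Y.K →+* T.K) (fun i => ι (X' (MvPolynomial.X i)))
          (MvPolynomial.map (algebraMap k Y.K) r) = ι (X' r)
        induction r using MvPolynomial.induction_on with
        | C a =>
          have : (MvPolynomial.C a : MvPolynomial σ k) = algebraMap k _ a := rfl
          rw [MvPolynomial.map_C, MvPolynomial.coe_eval₂Hom, MvPolynomial.eval₂_C, this,
            AlgHom.commutes, AlgHom.commutes]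
          exact φ.commutes a
        | add p q hp hq => simp only [map_add, hp, hq]
        | mul_X p i hp => simp only [map_mul, hp, MvPolynomial.map_X, MvPolynomial.coe_eval₂Hom,
            MvPolynomial.eval₂_X] }
  have hπC : ∀ a, π (MvPolynomial.C a) = φ a := fun a => MvPolynomial.eval₂_C _ _ _
  have hπX : ∀ i, π (MvPolynomial.X i) = ι (X' (MvPolynomial.X i)) :=
    fun i => MvPolynomial.eval₂_X _ _ _
  have hequiv : ∀ g P, π (mvPolynomialAct Y.action g P) = T.action g (π P) := by
    intro g P
    induction P using MvPolynomial.induction_on with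
    | C a => rw [mvPolynomialAct_C, hπC, hπC, hφ]
    | add p q hp hq => simp only [map_add, hp, hq]
    | mul_X p i hp =>
      rw [map_mul, map_mul, map_mul, map_mul, hp, mvPolynomialAct_X, hπX, hπX, hι]
      exact congrArg (fun z => _ * ι z) (fractionRingPerm_X g i).symm
  exact exists_stable_submodule Y.faithful hdim ht
    (ι.injective.comp (IsFractionRing.injective (MvPolynomial σ k) _)) π
    (fun g P hP => by rw [hequiv, hP, map_zero])
    (rank_le_of_finrank_fieldRange_le k ι (fun r => rfl) hd)

theorem EDLE.exists_stable_submodule [IsAlgClosed k] [Finite G] [Nontrivial G] [Finite σ]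
    [FaithfulSMul G σ] {d : ℕ} (h : EDLE k G d 1) :
    ∃ Y : GVariety k G, ∃ S : Submodule k Y.K, FiniteDimensional k S ∧ 2 ≤ Module.finrank k S ∧
      (∀ g, ∀ x ∈ S, Y.action g x ∈ S) ∧
      ∀ a ∈ S, ∀ b ∈ S, LinearIndependent k ![a, b] → ∀ H : Subgroup G,
        (∀ h ∈ H, Y.action h (a / b) = a / b) → Nat.card H ≤ d := by
  obtain ⟨T, Y, ⟨ι, hfin, hd, hι⟩, ⟨φ, hφ⟩, hdim⟩ := h (permGVariety k G σ)
  exact ⟨Y, exists_stable_submodule_of_cover (σ := σ) hdim ι hfin hd hι φ hφ⟩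

end Permutation

section Eigenspaces

open Module

variable {K V : Type*} [Field K] [IsAlgClosed K] [AddCommGroup V] [Module K V]
  [FiniteDimensional K V]

lemma finrank_eq_sum_eigenspace_of_pow_eq_one {p : ℕ} (hp : 0 < p) {ζ : K}
    (hζ : IsPrimitiveRoot ζ p) (A : End K V) (hA : A ^ p = 1) :
    finrank K V = ∑ i : Fin p, finrank K (A.eigenspace (ζ ^ (i : ℕ))) := by
  have hp0 : (p : K) ≠ 0 := by
    have : NeZero p := ⟨hp.ne'⟩
    exact hζ.neZero'.out
  have hss : A.IsSemisimple :=
    End.isSemisimple_of_squarefree_aeval_eq_zero (p := Polynomial.X ^ p - 1)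
      (Polynomial.X_pow_sub_one_separable_iff.2 hp0).squarefree (by simp [hA])
  have hinj : Function.Injective fun i : Fin p => ζ ^ (i : ℕ) := fun i j hij =>
    Fin.ext (hζ.pow_inj i.2 j.2 hij)
  have htop : ⨆ i : Fin p, A.eigenspace (ζ ^ (i : ℕ)) = ⊤ := by
    refine top_unique (hss.iSup_eigenspace_eq_top.ge.trans (iSup_le fun μ v hv => ?_))
    rw [End.mem_eigenspace_iff] at hv
    by_cases h0 : v = 0
    · rw [h0]; exact zero_mem _
    have hpow : ∀ n : ℕ, (A ^ n) v = μ ^ n • v := by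
      intro n
      induction n with
      | zero => simp
      | succ n ih => rw [pow_succ, Module.End.mul_apply, hv, map_smul, ih, smul_smul, pow_succ,
          mul_comm]
    have hμ : μ ^ p = 1 := by
      have h1 := hpow p
      rw [hA, End.one_apply] at h1
      by_contra hne
      have : (μ ^ p - 1) • v = 0 := by rw [sub_smul, one_smul, ← h1, sub_self]
      exact (smul_eq_zero.1 this).elim (fun h => hne (sub_eq_zero.1 h)) h0
    have : NeZero p := ⟨hp.ne'⟩
    obtain ⟨i, hi, rfl⟩ := hζ.eq_pow_of_pow_eq_one hμ
    exact le_iSup (fun i : Fin p => A.eigenspace (ζ ^ (i : ℕ))) ⟨i, hi⟩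
      (End.mem_eigenspace_iff.2 hv)
  have hint := DirectSum.isInternal_submodule_of_iSupIndep_of_iSup_eq_top
    (A.eigenspaces_iSupIndep.comp hinj) htop
  rw [← (LinearEquiv.ofBijective (DirectSum.coeLinearMap _) hint).finrank_eq,
    Module.finrank_directSum]
  rfl

lemma finrank_eq_sum_inf_eigenspace_of_pow_eq_one {p : ℕ} (hp : 0 < p) {ζ : K}
    (hζ : IsPrimitiveRoot ζ p) (A : End K V) (hA : A ^ p = 1) (U : Submodule K V)
    (hU : ∀ v ∈ U, A v ∈ U) :
    finrank K U = ∑ i : Fin p, finrank K ↥(U ⊓ A.eigenspace (ζ ^ (i : ℕ))) := by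
  rw [finrank_eq_sum_eigenspace_of_pow_eq_one hp hζ (A.restrict hU)]
  · refine Finset.sum_congr rfl fun i _ => ?_
    rw [End.eigenspace, End.genEigenspace_restrict, ← Submodule.finrank_map_subtype_eq,
      Submodule.map_comap_subtype]
  · ext v
    rw [Module.End.pow_restrict]
    exact LinearMap.congr_fun hA v

end Eigenspaces

section Alternating

open Module

lemma Subgroup.lt_card_closure_of_list {G : Type*} [Group G] [Finite G] {s : Set G} (l : List G)
    (hl : l.Nodup) (h : ∀ x ∈ l, x ∈ Subgroup.closure s) :
    l.length ≤ Nat.card (Subgroup.closure s) := by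
  classical
  have h1 : (l.toFinset : Set G) ⊆ Subgroup.closure s := fun x hx => h x (by simpa using hx)
  have h2 := Set.ncard_le_ncard h1 (Set.toFinite _)
  rwa [Set.ncard_coe_finset, List.toFinset_card_of_nodup hl] at h2

variable {K V G : Type*} [Field K] [AddCommGroup V] [Module K V] [Group G]

lemma map_mem_eigenspace_of_mul_eq_mul_pow (ρ : G →* End K V) {h x y : G} {a : ℕ}
    (hxy : y * h = h * x ^ a) {μ : K} {v : V} (hv : v ∈ (ρ x).eigenspace μ) :
    ρ h v ∈ (ρ y).eigenspace (μ ^ a) := by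
  rw [End.mem_eigenspace_iff] at hv ⊢
  have hpow : ∀ n : ℕ, ρ (x ^ n) v = μ ^ n • v := by
    intro n
    induction n with
    | zero => simp
    | succ n ih => rw [pow_succ, map_mul, End.mul_apply, hv, map_smul, ih, smul_smul, pow_succ,
        mul_comm]
  rw [← End.mul_apply, ← map_mul, hxy, map_mul, End.mul_apply, hpow, map_smul]

lemma finrank_le_of_map_mem [FiniteDimensional K V] (ρ : G →* End K V) (h : G)
    {U W : Submodule K V} (hUW : ∀ v ∈ U, ρ h v ∈ W) : finrank K U ≤ finrank K W := by
  have hinj : Function.Injective (ρ h) := fun v w hvw => by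
    have := congrArg (ρ h⁻¹) hvw
    rwa [← End.mul_apply, ← End.mul_apply, ← map_mul, inv_mul_cancel, map_one] at this
  exact LinearMap.finrank_le_finrank_of_injective (f := (ρ h).restrict hUW)
    fun v w hvw => Subtype.ext (hinj (congrArg Subtype.val hvw))

/-- The product of transpositions `(a b)(c d)`. -/
def alternatingGroup.swapMulSwap {n : ℕ} (a b c d : Fin n) (hab : a ≠ b) (hcd : c ≠ d) :
    alternatingGroup (Fin n) :=
  ⟨Equiv.swap a b * Equiv.swap c d, by
    rw [Equiv.Perm.mem_alternatingGroup, Equiv.Perm.sign_mul, Equiv.Perm.sign_swap hab,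
      Equiv.Perm.sign_swap hcd]; rfl⟩

lemma le_one_of_character_multiplicities {n p q a x₀ y₀ x₁ y₁ z₀ z₁ z₃ : ℕ} (hp : p ≤ 1)
    (hq : q ≤ 1) (ha : a ≤ 1) (hx₀ : x₀ ≤ 1) (hx₁ : x₁ ≤ 1)
    (hz₀ : z₀ ≤ 1) (hz₁ : z₁ ≤ 1) (hz₃ : z₃ ≤ 1)
    (hn : n = a + (p + p) + (p + (q + q) + (p + (q + q))))
    (h₀ : a + (p + p) = x₀ + 3 * y₀) (h₁ : p + (q + q) = x₁ + 3 * y₁)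
    (hnz : n = z₀ + 3 * z₁ + 3 * z₃) : n ≤ 1 := by
  interval_cases p <;> interval_cases q <;> omega

open alternatingGroup in
theorem finrank_le_one_of_alternatingGroup_seven [IsAlgClosed K] [CharZero K]
    [FiniteDimensional K V] (ρ : alternatingGroup (Fin 7) →* End K V)
    (hρ : ∀ (U : Submodule K V) (s : Set (alternatingGroup (Fin 7))),
      (∀ g ∈ s, ∃ μ, U ≤ (ρ g).eigenspace μ) → 6 < Nat.card (Subgroup.closure s) →
      finrank K U ≤ 1) :
    finrank K V ≤ 1 := by
  obtain ⟨ω, hω⟩ := HasEnoughRootsOfUnity.exists_primitiveRoot K 3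
  obtain ⟨ζ, hζ⟩ := HasEnoughRootsOfUnity.exists_primitiveRoot K 7
  obtain ⟨ε, hε⟩ := HasEnoughRootsOfUnity.exists_primitiveRoot K 2
  obtain ⟨c, hc⟩ : ∃ c, c = swapMulSwap (0 : Fin 7) 1 1 2 (by decide) (by decide) := ⟨_, rfl⟩
  obtain ⟨d, hd⟩ : ∃ d, d = swapMulSwap (3 : Fin 7) 4 4 5 (by decide) (by decide) := ⟨_, rfl⟩
  obtain ⟨v, hv⟩ : ∃ v, v = swapMulSwap (3 : Fin 7) 4 5 6 (by decide) (by decide) := ⟨_, rfl⟩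
  obtain ⟨w, hw⟩ : ∃ w, w = swapMulSwap (3 : Fin 7) 5 4 6 (by decide) (by decide) := ⟨_, rfl⟩
  obtain ⟨s, hs⟩ : ∃ s, s = c * swapMulSwap (2 : Fin 7) 3 3 4 (by decide) (by decide) *
    swapMulSwap (4 : Fin 7) 5 5 6 (by decide) (by decide) := ⟨_, rfl⟩
  obtain ⟨t, ht⟩ : ∃ t, t = swapMulSwap (1 : Fin 7) 2 2 4 (by decide) (by decide) *
    swapMulSwap (3 : Fin 7) 6 6 5 (by decide) (by decide) := ⟨_, rfl⟩
  obtain ⟨g, hg⟩ : ∃ g, g = swapMulSwap (0 : Fin 7) 3 1 4 (by decide) (by decide) *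
    swapMulSwap (4 : Fin 7) 2 2 5 (by decide) (by decide) := ⟨_, rfl⟩
  have hpow {p : ℕ} {x : alternatingGroup (Fin 7)} (h : x ^ p = 1) : ρ x ^ p = 1 := by
    rw [← map_pow, h, map_one]
  have hc3 : c ^ 3 = 1 := by subst_vars; decide +kernel
  have hd3 : d ^ 3 = 1 := by subst_vars; decide +kernel
  have hv2 : v ^ 2 = 1 := by subst_vars; decide +kernel
  have hw2 : w ^ 2 = 1 := by subst_vars; decide +kernel
  have hs7 : s ^ 7 = 1 := by subst_vars; decide +kernel
  have hcd : c * d = d * c ^ 1 := by subst_vars; decide +kernel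
  have hcv : c * v = v * c ^ 1 := by subst_vars; decide +kernel
  have hcw : c * w = w * c ^ 1 := by subst_vars; decide +kernel
  have hvw : v * w = w * v ^ 1 := by subst_vars; decide +kernel
  have hdg : d * g = g * c ^ 1 := by subst_vars; decide +kernel
  have hcg : c * g = g * d ^ 2 := by subst_vars; decide +kernel
  have hst : s * t = t * s ^ 4 := by subst_vars; decide +kernel
  have hvd : v * d = d * w ^ 1 := by subst_vars; decide +kernel
  have hwd : w * d = d * (v * w) ^ 1 := by subst_vars; decide +kernel
  have mem {S : Set (alternatingGroup (Fin 7))} {x} (hx : x ∈ S) : x ∈ Subgroup.closure S :=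
    Subgroup.subset_closure hx
  have card_cd : 6 < Nat.card (Subgroup.closure {c, d}) := by
    have h1 : c ∈ Subgroup.closure {c, d} := mem (by simp)
    have h2 : d ∈ Subgroup.closure {c, d} := mem (by simp)
    refine Subgroup.lt_card_closure_of_list [1, c, c * c, d, d * d, c * d, c * c * d]
      (by subst_vars; decide +kernel) ?_
    simp [h1, h2, mul_mem, one_mem]
  have card_cvw : 6 < Nat.card (Subgroup.closure {c, v, w}) := by
    have h1 : c ∈ Subgroup.closure {c, v, w} := mem (by simp)
    have h2 : v ∈ Subgroup.closure {c, v, w} := mem (by simp)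
    have h3 : w ∈ Subgroup.closure {c, v, w} := mem (by simp)
    refine Subgroup.lt_card_closure_of_list [1, c, c * c, v, w, c * v, c * w]
      (by subst_vars; decide +kernel) ?_
    simp [h1, h2, h3, mul_mem, one_mem]
  have card_s : 6 < Nat.card (Subgroup.closure {s}) := by
    have h1 : s ∈ Subgroup.closure {s} := mem (by simp)
    refine Subgroup.lt_card_closure_of_list [1, s, s ^ 2, s ^ 3, s ^ 4, s ^ 5, s ^ 6]
      (by subst_vars; decide +kernel) ?_
    simp [h1, pow_mem, one_mem]
  -- The multiplicities of the characters of `⟨s⟩`.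
  obtain ⟨z, hz⟩ : ∃ z : ℕ → ℕ, ∀ i, z i = finrank K ((ρ s).eigenspace (ζ ^ i)) :=
    ⟨_, fun _ => rfl⟩
  have hz1 (i : ℕ) : z i ≤ 1 := hz i ▸ hρ _ {s} (by simpa using ⟨_, le_rfl⟩) card_s
  have hz4 (i : ℕ) : z i ≤ z (i * 4) := by
    rw [hz, hz, pow_mul]
    exact finrank_le_of_map_mem ρ t fun x hx => map_mem_eigenspace_of_mul_eq_mul_pow ρ hst hx
  have hz7 (i : ℕ) : z (i + 7) = z i := by rw [hz, hz, pow_add, hζ.pow_eq_one, mul_one]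
  have hzn := finrank_eq_sum_eigenspace_of_pow_eq_one (by decide) hζ _ (hpow hs7)
  -- The multiplicities of the characters of `⟨c⟩`.
  obtain ⟨r, hr⟩ : ∃ r : ℕ → ℕ, ∀ i, r i = finrank K ((ρ c).eigenspace (ω ^ i)) :=
    ⟨_, fun _ => rfl⟩
  have hrn := finrank_eq_sum_eigenspace_of_pow_eq_one (by decide) hω _ (hpow hc3)
  -- The multiplicities of the characters of `⟨c, d⟩`.
  obtain ⟨m, hm⟩ : ∃ m : ℕ → ℕ → ℕ, ∀ i j, m i j =
      finrank K ↥((ρ c).eigenspace (ω ^ i) ⊓ (ρ d).eigenspace (ω ^ j)) := ⟨_, fun _ _ => rfl⟩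
  have hm1 (i j : ℕ) : m i j ≤ 1 := hm i j ▸ hρ _ {c, d}
    (by simpa using ⟨⟨_, inf_le_left⟩, ⟨_, inf_le_right⟩⟩) card_cd
  have hmg (i j : ℕ) : m i j ≤ m (j * 2) i := by
    rw [hm, hm, pow_mul]
    refine finrank_le_of_map_mem ρ g fun x hx => ⟨?_, ?_⟩
    · exact map_mem_eigenspace_of_mul_eq_mul_pow ρ hcg hx.2
    · simpa using map_mem_eigenspace_of_mul_eq_mul_pow ρ hdg hx.1
  have hm3 (i j : ℕ) : m (i + 3) j = m i j := by rw [hm, hm, pow_add, hω.pow_eq_one, mul_one]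
  have hrm (i : ℕ) := finrank_eq_sum_inf_eigenspace_of_pow_eq_one (by decide) hω _ (hpow hd3)
    ((ρ c).eigenspace (ω ^ i)) fun x hx => by
      simpa using map_mem_eigenspace_of_mul_eq_mul_pow ρ hcd hx
  -- The multiplicities of the characters of `⟨c, v, w⟩`.
  obtain ⟨y, hy⟩ : ∃ y : ℕ → ℕ → ℕ → ℕ, ∀ i a b, y i a b =
      finrank K ↥((ρ c).eigenspace (ω ^ i) ⊓ (ρ v).eigenspace (ε ^ a) ⊓
        (ρ w).eigenspace (ε ^ b)) := ⟨_, fun _ _ _ => rfl⟩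
  have hy1 (i a b : ℕ) : y i a b ≤ 1 := hy i a b ▸ hρ _ {c, v, w}
    (by simpa using ⟨⟨_, inf_le_left.trans inf_le_left⟩, ⟨_, inf_le_left.trans inf_le_right⟩,
      ⟨_, inf_le_right⟩⟩) card_cvw
  have hyd (i a b : ℕ) : y i a b ≤ y i b (a + b) := by
    rw [hy, hy]
    refine finrank_le_of_map_mem ρ d fun x hx => ⟨⟨?_, ?_⟩, ?_⟩
    · simpa using map_mem_eigenspace_of_mul_eq_mul_pow ρ hcd hx.1.1
    · simpa using map_mem_eigenspace_of_mul_eq_mul_pow ρ hvd hx.2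
    · have h1 : x ∈ (ρ (v * w)).eigenspace (ε ^ (a + b)) := by
        have hxv := End.mem_eigenspace_iff.1 hx.1.2
        have hxw := End.mem_eigenspace_iff.1 hx.2
        rw [End.mem_eigenspace_iff, map_mul, End.mul_apply, hxw, map_smul, hxv, smul_smul,
          pow_add, mul_comm]
      simpa using map_mem_eigenspace_of_mul_eq_mul_pow ρ hwd h1
  have hy2 (i a b : ℕ) : y i a (b + 2) = y i a b := by
    rw [hy, hy, pow_add, hε.pow_eq_one, mul_one]
  have hrv (i : ℕ) := finrank_eq_sum_inf_eigenspace_of_pow_eq_one (by decide) hε _ (hpow hv2)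
    ((ρ c).eigenspace (ω ^ i)) fun x hx => by
      simpa using map_mem_eigenspace_of_mul_eq_mul_pow ρ hcv hx
  have hrw (i a : ℕ) := finrank_eq_sum_inf_eigenspace_of_pow_eq_one (by decide) hε _ (hpow hw2)
    ((ρ c).eigenspace (ω ^ i) ⊓ (ρ v).eigenspace (ε ^ a)) fun x hx => by
      refine ⟨?_, ?_⟩
      · simpa using map_mem_eigenspace_of_mul_eq_mul_pow ρ hcw hx.1
      · simpa using map_mem_eigenspace_of_mul_eq_mul_pow ρ hvw hx.2
  have hry (i : ℕ) : r i = y i 0 0 + 3 * y i 0 1 := by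
    have h1 : r i = y i 0 0 + y i 0 1 + (y i 1 0 + y i 1 1) := by
      simp only [hr, hy, hrv, hrw, Fin.sum_univ_succ, Fin.sum_univ_zero]
      simp
    have h2 : y i 0 1 ≤ y i 1 1 := hyd i 0 1
    have h3 : y i 1 1 ≤ y i 1 0 := (hyd i 1 1).trans (hy2 i 1 0).le
    have h4 : y i 1 0 ≤ y i 0 1 := hyd i 1 0
    omega
  simp only [← hz, Fin.sum_univ_succ, Fin.sum_univ_zero] at hzn
  simp only [← hr, Fin.sum_univ_succ, Fin.sum_univ_zero] at hrn
  simp only [← hr, ← hm, Fin.sum_univ_succ, Fin.sum_univ_zero] at hrm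
  simp at hzn hrn hrm
  have hz14 : z 1 ≤ z 4 := hz4 1
  have hz42 : z 4 ≤ z 2 := (hz4 4).trans_eq ((hz7 9).trans (hz7 2))
  have hz21 : z 2 ≤ z 1 := (hz4 2).trans_eq (hz7 1)
  have hz35 : z 3 ≤ z 5 := (hz4 3).trans_eq (hz7 5)
  have hz56 : z 5 ≤ z 6 := (hz4 5).trans_eq ((hz7 13).trans (hz7 6))
  have hz63 : z 6 ≤ z 3 := (hz4 6).trans_eq ((hz7 17).trans ((hz7 10).trans (hz7 3)))
  have hm01 : m 0 1 ≤ m 2 0 := hmg 0 1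
  have hm20 : m 2 0 ≤ m 0 2 := hmg 2 0
  have hm02 : m 0 2 ≤ m 1 0 := (hmg 0 2).trans_eq (hm3 1 0)
  have hm10 : m 1 0 ≤ m 0 1 := hmg 1 0
  have hm11 : m 1 1 ≤ m 2 1 := hmg 1 1
  have hm21 : m 2 1 ≤ m 2 2 := hmg 2 1
  have hm22 : m 2 2 ≤ m 1 2 := (hmg 2 2).trans_eq (hm3 1 2)
  have hm12 : m 1 2 ≤ m 1 1 := (hmg 1 2).trans_eq (hm3 1 1)
  have hr0 := hrm 0
  have hr1 := hrm 1
  have hr2 := hrm 2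
  have hy0 := hry 0
  have hy1' := hry 1
  have hy2' := hry 2
  have e1 : z 2 = z 1 ∧ z 4 = z 1 := by clear * - hz14 hz42 hz21; omega
  have e2 : z 5 = z 3 ∧ z 6 = z 3 := by clear * - hz35 hz56 hz63; omega
  have e3 : m 2 0 = m 0 1 ∧ m 0 2 = m 0 1 ∧ m 1 0 = m 0 1 := by
    clear * - hm01 hm20 hm02 hm10; omega
  have e4 : m 2 1 = m 1 1 ∧ m 2 2 = m 1 1 ∧ m 1 2 = m 1 1 := by
    clear * - hm11 hm21 hm22 hm12; omega
  rw [e1.1, e1.2, e2.1, e2.2] at hzn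
  rw [e3.2.1] at hr0
  rw [e3.2.2, e4.2.2] at hr1
  rw [e3.1, e4.1, e4.2.1] at hr2
  exact le_one_of_character_multiplicities (hm1 0 1) (hm1 1 1) (hm1 0 0) (hy1 0 0 0)
    (hy1 1 0 0) (hz1 0) (hz1 1) (hz1 3) (by omega) (hr0.symm.trans hy0)
    (hr1.symm.trans hy1') (by omega)

end Alternating

section StableSubspace

variable {k G : Type} [Field k] [Group G]

/-- The linear representation of `G` on a `G`-stable space of rational functions. -/
def GVariety.stableRep (Y : GVariety k G) (S : Submodule k Y.K)
    (hS : ∀ g, ∀ x ∈ S, Y.action g x ∈ S) : G →* Module.End k S where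
  toFun g := (Y.action g).toLinearMap.restrict (hS g)
  map_one' := by ext v; simp
  map_mul' g h := by ext v; simp only [map_mul]; rfl

lemma GVariety.finrank_le_one_of_le_eigenspace (Y : GVariety k G) {S : Submodule k Y.K}
    (hS : ∀ g, ∀ x ∈ S, Y.action g x ∈ S) {d : ℕ}
    (hd : ∀ a ∈ S, ∀ b ∈ S, LinearIndependent k ![a, b] → ∀ H : Subgroup G,
      (∀ h ∈ H, Y.action h (a / b) = a / b) → Nat.card H ≤ d)
    (U : Submodule k S) (s : Set G) (hU : ∀ g ∈ s, ∃ μ, U ≤ (Y.stableRep S hS g).eigenspace μ)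
    (hs : d < Nat.card (Subgroup.closure s)) : Module.finrank k U ≤ 1 := by
  by_contra! hlt
  obtain ⟨f, hf⟩ := exists_linearIndependent_of_le_finrank (R := k) (M := U) hlt
  have hf' : LinearIndependent k fun i => ((f i : S) : Y.K) :=
    hf.map_injOn (S.subtype ∘ₗ U.subtype)
      (Subtype.val_injective.comp Subtype.val_injective).injOn
  have hab : LinearIndependent k ![((f 0 : S) : Y.K), ((f 1 : S) : Y.K)] := by
    convert hf' using 1
    ext i
    fin_cases i <;> rfl
  refine (hd _ (f 0 : S).2 _ (f 1 : S).2 hab (Subgroup.closure s) fun g hg => ?_).not_gt hs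
  induction hg using Subgroup.closure_induction with
  | one => rw [map_one, AlgEquiv.one_apply]
  | mul x y _ _ hx hy => rw [map_mul, AlgEquiv.mul_apply, hy, hx]
  | inv x _ hx =>
    rw [map_inv]
    exact (AlgEquiv.symm_apply_eq _).2 hx.symm
  | mem x hx =>
    obtain ⟨μ, hμ⟩ := hU x hx
    have hact (i) : Y.action x ((f i : S) : Y.K) = μ • ((f i : S) : Y.K) :=
      congrArg Subtype.val (Module.End.mem_eigenspace_iff.1 (hμ (f i).2))
    have hμ0 : μ ≠ 0 := by
      rintro rfl
      have h0 := hact 0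
      rw [zero_smul, map_eq_zero_iff _ (Y.action x).injective] at h0
      exact hab.ne_zero 0 h0
    rw [map_div₀, hact, hact, Algebra.smul_def, Algebra.smul_def,
      mul_div_mul_left _ _ (by simpa using hμ0)]

end StableSubspace

/-- For the alternating group `A₇`, one has `ed_ℂ(A₇; ≤ 6) > 1`. -/
theorem edC_A7_le_six_gt_one :
    ¬ EDLE ℂ (alternatingGroup (Fin 7)) 6 1 := by
  intro h
  have : Nontrivial (alternatingGroup (Fin 7)) :=
    alternatingGroup.nontrivial_of_three_le_card (by simp)
  obtain ⟨Y, S, hfin, hS, hstab, hcard⟩ := h.exists_stable_submodule (σ := Fin 7)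
  exact absurd (hS.trans (finrank_le_one_of_alternatingGroup_seven (Y.stableRep S hstab)
    (Y.finrank_le_one_of_le_eigenspace hstab hcard))) (by decide)
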